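/- Let {X_n}_{n≥1} be a symmetric two-state correlated random walk on {1,-1} with parameter 0<p<1 (i.e., p=q), started from the stationary distribution (1/2,1/2), and let S_n = X_1+···+X_n. Then with a = (2p-1)/(1-p) and b = p/(1-p), the process M_n = S_n² + a·S_n·X_n - b·n is a martingale with respect to the filtration F_n = σ(X_1,...,X_n). -/

import Mathlib

open MeasureTheory ProbabilityTheory Set

noncomputable section

variable {Ω : Type*} [MeasurableSpace Ω]

/-- The σ-algebra `σ(X_1, …, X_n)` generated by the first `n` steps of the process. -/
def sigmaUpTo (X : ℕ → Ω → ℝ) (n : ℕ) : MeasurableSpace Ω :=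
  ⨆ i ∈ Finset.Icc 1 n, MeasurableSpace.comap (X i) inferInstance

/-- The transition kernel of a two-state correlated random walk on `{1, -1}`:
from state `1` go to `1` with probability `p`; from state `-1` go to `-1`
with probability `q`. -/
def crwKernel (p q : ℝ) (i j : ℝ) : ℝ :=
  if i = 1 then (if j = 1 then p else 1 - p)
  else (if j = -1 then q else 1 - q)

/-- `X` is a two-state correlated random walk on `{1, -1}` with parameters `p, q`,
started from the stationary distribution `((1-q)/(2-p-q), (1-p)/(2-p-q))`:
each `X n` (for `n ≥ 1`) is measurable with values in `{1, -1}`, the initial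
distribution is stationary, and the Markov property with the prescribed
time-homogeneous transition probabilities holds, conditionally on
`F n = σ(X_1, …, X_n)`. -/
def IsCRW (μ : Measure Ω) (X : ℕ → Ω → ℝ) (p q : ℝ) : Prop :=
  (∀ i, 1 ≤ i → Measurable (X i)) ∧
  (∀ n, 1 ≤ n → ∀ ω, X n ω = 1 ∨ X n ω = -1) ∧
  (μ {ω | X 1 ω = 1} = ENNReal.ofReal ((1 - q) / (2 - p - q))) ∧
  (∀ n, 1 ≤ n → ∀ i ∈ ({1, -1} : Set ℝ), ∀ j ∈ ({1, -1} : Set ℝ),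
    ∀ E : Set Ω, MeasurableSet[sigmaUpTo X n] E →
      μ (E ∩ {ω | X n ω = i ∧ X (n + 1) ω = j})
        = ENNReal.ofReal (crwKernel p q i j) * μ (E ∩ {ω | X n ω = i}))

/-- The natural filtration `F_{k+1} = σ(X_1, …, X_{k+1})`, shifted so that the
index `k : ℕ` corresponds to time `k + 1` (processes in the paper start at time 1). -/
def crwFiltration (X : ℕ → Ω → ℝ) (hX : ∀ i, 1 ≤ i → Measurable (X i)) :
    Filtration ℕ (inferInstance : MeasurableSpace Ω) where
  seq k := sigmaUpTo X (k + 1)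
  mono' a b hab := by
    refine biSup_mono fun i hi => ?_
    simp only [Finset.mem_Icc] at *
    omega
  le' k := iSup₂_le fun i hi => (hX i (Finset.mem_Icc.mp hi).1).comap_le

theorem measurable_sigmaUpTo {α : Type*} (X : ℕ → α → ℝ) {i n : ℕ} (hi : i ∈ Finset.Icc 1 n) :
    Measurable[sigmaUpTo X n] (X i) :=
  Measurable.mono (comap_measurable (X i))
    (le_iSup₂ (f := fun j (_ : j ∈ Finset.Icc 1 n) =>
      MeasurableSpace.comap (X j) inferInstance) i hi) le_rfl

theorem sigmaUpTo_le {X : ℕ → Ω → ℝ} (hX : ∀ i, 1 ≤ i → Measurable (X i)) (n : ℕ) :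
    sigmaUpTo X n ≤ (inferInstance : MeasurableSpace Ω) :=
  iSup₂_le fun i hi => (hX i (Finset.mem_Icc.mp hi).1).comap_le

namespace IsCRW

variable {μ : Measure Ω} {X : ℕ → Ω → ℝ} {p q : ℝ}

theorem abs_eq_one (hX : IsCRW μ X p q) {n : ℕ} (hn : 1 ≤ n) (ω : Ω) : |X n ω| = 1 := by
  rcases hX.2.1 n hn ω with h | h <;> simp [h]

theorem integrable [IsFiniteMeasure μ] (hX : IsCRW μ X p q) {n : ℕ} (hn : 1 ≤ n) :
    Integrable (X n) μ :=
  Integrable.of_bound (hX.1 n hn).aestronglyMeasurable 1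
    (ae_of_all _ fun ω => by simp [hX.abs_eq_one hn])

theorem measureReal_inter [IsFiniteMeasure μ] (hX : IsCRW μ X p q) {n : ℕ} (hn : 1 ≤ n)
    {i j : ℝ} (hi : i ∈ ({1, -1} : Set ℝ)) (hj : j ∈ ({1, -1} : Set ℝ))
    (hK : 0 ≤ crwKernel p q i j) {E : Set Ω} (hE : MeasurableSet[sigmaUpTo X n] E) :
    μ.real (E ∩ {ω | X n ω = i ∧ X (n + 1) ω = j})
      = crwKernel p q i j * μ.real (E ∩ {ω | X n ω = i}) := by
  simp [measureReal_def, hX.2.2.2 n hn i hi j hj E hE, ENNReal.toReal_mul,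
    ENNReal.toReal_ofReal hK]

/-- The innovations of a symmetric walk integrate to zero over past events. -/
theorem setIntegral_innovation_eq_zero [IsFiniteMeasure μ] (hX : IsCRW μ X p p)
    (hp0 : 0 ≤ p) (hp1 : p ≤ 1) {n : ℕ} (hn : 1 ≤ n)
    {E : Set Ω} (hE : MeasurableSet[sigmaUpTo X n] E) :
    ∫ ω in E, (X (n + 1) ω - (2 * p - 1) * X n ω) ∂μ = 0 := by
  have hm : ∀ i j : ℝ, MeasurableSet {ω | X n ω = i ∧ X (n + 1) ω = j} := fun i j =>
    (hX.1 n hn (measurableSet_singleton i)).inter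
      (hX.1 (n + 1) (by omega) (measurableSet_singleton j))
  let f : ℝ → ℝ → Ω → ℝ := fun i j =>
    indicator {ω | X n ω = i ∧ X (n + 1) ω = j} fun _ => j - (2 * p - 1) * i
  have hf : ∀ i j, Integrable (f i j) (μ.restrict E) := fun i j =>
    (integrable_const _).indicator (hm i j)
  have hint : ∀ i j, ∫ ω in E, f i j ω ∂μ
      = μ.real (E ∩ {ω | X n ω = i ∧ X (n + 1) ω = j}) * (j - (2 * p - 1) * i) := by
    intro i j
    simp only [f]
    rw [setIntegral_indicator (hm i j), setIntegral_const, smul_eq_mul]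
  have hsplit : ∀ ω, X (n + 1) ω - (2 * p - 1) * X n ω
      = (f 1 1 ω + f 1 (-1) ω) + (f (-1) 1 ω + f (-1) (-1) ω) := by
    intro ω
    rcases hX.2.1 n hn ω with h | h <;> rcases hX.2.1 (n + 1) (by omega) ω with h' | h' <;>
      norm_num [f, indicator, h, h']
  simp_rw [hsplit]
  rw [integral_add ((hf 1 1).fun_add (hf 1 (-1))) ((hf (-1) 1).fun_add (hf (-1) (-1))),
    integral_add (hf _ _) (hf _ _), integral_add (hf _ _) (hf _ _)]
  have hK : ∀ i j, 0 ≤ crwKernel p p i j := by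
    intro i j
    unfold crwKernel
    split_ifs <;> linarith
  simp only [hint]
  rw [hX.measureReal_inter hn (by simp) (by simp) (hK _ _) hE,
    hX.measureReal_inter hn (by simp) (by simp) (hK _ _) hE,
    hX.measureReal_inter hn (by simp) (by simp) (hK _ _) hE,
    hX.measureReal_inter hn (by simp) (by simp) (hK _ _) hE]
  norm_num [crwKernel]
  ring

theorem condExp_innovation_eq_zero [IsFiniteMeasure μ] (hX : IsCRW μ X p p)
    (hp0 : 0 ≤ p) (hp1 : p ≤ 1) {n : ℕ} (hn : 1 ≤ n) :
    μ[fun ω => X (n + 1) ω - (2 * p - 1) * X n ω | sigmaUpTo X n] =ᵐ[μ] 0 := by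
  refine (ae_eq_condExp_of_forall_setIntegral_eq (sigmaUpTo_le hX.1 n)
    ((hX.integrable (by omega)).sub ((hX.integrable hn).const_mul _))
    (fun _ _ _ => integrableOn_zero) (fun E hE _ => ?_) aestronglyMeasurable_zero).symm
  simp [hX.setIntegral_innovation_eq_zero hp0 hp1 hn hE]

end IsCRW

/-- For the symmetric two-state CRW (`p = q`) started from the stationary
distribution `(1/2, 1/2)`, with `a = (2p-1)/(1-p)` and `b = p/(1-p)`, the process
`M_n = S_n² + a·S_n·X_n - b·n` is a martingale with respect to the natural
filtration `F_n = σ(X_1, …, X_n)`. -/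
theorem crw_symmetric_quadratic_martingale
    (μ : Measure Ω) [IsProbabilityMeasure μ] (X : ℕ → Ω → ℝ) (p : ℝ)
    (hp0 : 0 < p) (hp1 : p < 1) (hX : IsCRW μ X p p)
    (S : ℕ → Ω → ℝ) (hS : ∀ n ω, S n ω = ∑ i ∈ Finset.Icc 1 n, X i ω)
    (a b : ℝ) (ha : a = (2 * p - 1) / (1 - p)) (hb : b = p / (1 - p)) :
    Martingale
      (fun k => fun ω =>
        (S (k + 1) ω) ^ 2 + a * S (k + 1) ω * X (k + 1) ω - b * ((k : ℝ) + 1))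
      (crwFiltration X hX.1) μ := by
  have hSm : ∀ n, Measurable[sigmaUpTo X n] (S n) := by
    intro n
    rw [show S n = fun ω => ∑ i ∈ Finset.Icc 1 n, X i ω from funext (hS n)]
    exact Finset.measurable_fun_sum _ fun i hi => measurable_sigmaUpTo X hi
  have hSb : ∀ n ω, |S n ω| ≤ n := by
    intro n ω
    rw [hS]
    refine (Finset.abs_sum_le_sum_abs _ _).trans ?_
    rw [Finset.sum_congr rfl fun i hi => hX.abs_eq_one (Finset.mem_Icc.mp hi).1 ω]
    simp
  have hXm : ∀ k, Measurable[sigmaUpTo X (k + 1)] (X (k + 1)) := fun k =>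
    measurable_sigmaUpTo X (by simp)
  have hMm : ∀ k : ℕ, Measurable[sigmaUpTo X (k + 1)] fun ω =>
      (S (k + 1) ω) ^ 2 + a * S (k + 1) ω * X (k + 1) ω - b * ((k : ℝ) + 1) := fun k =>
    (((hSm _).pow_const 2).add (((hSm _).const_mul a).mul (hXm k))).sub_const _
  refine martingale_of_condExp_sub_eq_zero_nat (fun k => (hMm k).stronglyMeasurable)
    (fun k => ?_) fun k => ?_
  · refine Integrable.of_bound
      ((hMm k).mono (sigmaUpTo_le hX.1 _) le_rfl).aestronglyMeasurable
      (((k + 1 : ℕ) : ℝ) ^ 2 + |a| * ((k + 1 : ℕ) : ℝ) + |b * ((k : ℝ) + 1)|)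
      (ae_of_all _ fun ω => ?_)
    rw [Real.norm_eq_abs]
    refine (abs_sub _ _).trans (add_le_add_left ((abs_add_le _ _).trans ?_) _)
    rw [abs_pow, abs_mul, abs_mul, hX.abs_eq_one (by omega), mul_one]
    have := hSb (k + 1) ω
    gcongr
  · have hp : 1 - p ≠ 0 := by linarith
    have hdiff : ((fun ω => (S (k + 1 + 1) ω) ^ 2 + a * S (k + 1 + 1) ω * X (k + 1 + 1) ω
          - b * (((k + 1 : ℕ) : ℝ) + 1))
        - fun ω => (S (k + 1) ω) ^ 2 + a * S (k + 1) ω * X (k + 1) ω - b * ((k : ℝ) + 1))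
        = (fun ω => (2 + a) * S (k + 1) ω)
          * fun ω => X (k + 1 + 1) ω - (2 * p - 1) * X (k + 1) ω := by
      funext ω
      have hsucc : S (k + 1 + 1) ω = S (k + 1) ω + X (k + 1 + 1) ω := by
        rw [hS, hS, Finset.sum_Icc_succ_top (by omega)]
      have hsq : X (k + 1 + 1) ω ^ 2 = 1 := by
        rw [← sq_abs, hX.abs_eq_one (by omega), one_pow]
      have ham : (2 + a) * (2 * p - 1) = a := by
        rw [ha]; field_simp; ring
      have hab : 1 + a = b := by
        rw [ha, hb]; field_simp; ring
      simp only [Pi.sub_apply, Pi.mul_apply, hsucc]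
      push_cast
      linear_combination (1 + a) * hsq + S (k + 1) ω * X (k + 1) ω * ham + hab
    have hD : Integrable (fun ω => X (k + 1 + 1) ω - (2 * p - 1) * X (k + 1) ω) μ :=
      (hX.integrable (by omega)).sub ((hX.integrable (by omega)).const_mul _)
    have hcm : Measurable[sigmaUpTo X (k + 1)] fun ω => (2 + a) * S (k + 1) ω :=
      (hSm _).const_mul _
    have hprod : Integrable ((fun ω => (2 + a) * S (k + 1) ω)
        * fun ω => X (k + 1 + 1) ω - (2 * p - 1) * X (k + 1) ω) μ := by
      refine hD.bdd_mul (c := |2 + a| * ((k + 1 : ℕ) : ℝ))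
        (hcm.mono (sigmaUpTo_le hX.1 _) le_rfl).aestronglyMeasurable
        (ae_of_all _ fun ω => ?_)
      rw [Real.norm_eq_abs, abs_mul]
      exact mul_le_mul_of_nonneg_left (hSb _ ω) (abs_nonneg _)
    rw [hdiff]
    filter_upwards [condExp_mul_of_stronglyMeasurable_left hcm.stronglyMeasurable hprod hD,
      hX.condExp_innovation_eq_zero hp0.le hp1.le (n := k + 1) (by omega)] with ω h₁ h₂
    refine h₁.trans ?_
    simp [h₂]
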